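/- Let u : ℝ → ℝ be continuous with u(t + 2π) = u(t) for all t, and let m := (1/(2π)) ∫_{0}^{2π} u(t) dt. Define g : ℝ → ℝ by g(τ) := (1/(2π)) ∫_{0}^{2π} ( ∫_{0}^{t} (u(τ + s) − m) ds ) dt. Then g is differentiable on ℝ and g'(τ) = m − u(τ) for every τ ∈ ℝ. -/

import Mathlib

/-- solvability of the cohomological equation along a 2π-periodic
orbit: if `u` is continuous and 2π-periodic with mean `m`, then
`g(τ) = (1/2π)∫₀^{2π} (∫₀^t (u(τ+s) − m) ds) dt` satisfies `g'(τ) = m − u(τ)`. -/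
theorem stmt18 (u : ℝ → ℝ) (hu : Continuous u)
    (hper : ∀ t : ℝ, u (t + 2*Real.pi) = u t)
    (m : ℝ) (hm : m = (1/(2*Real.pi)) * ∫ t in (0:ℝ)..(2*Real.pi), u t)
    (g : ℝ → ℝ)
    (hg : g = fun τ => (1/(2*Real.pi)) *
      ∫ t in (0:ℝ)..(2*Real.pi), ∫ s in (0:ℝ)..t, (u (τ + s) - m)) :
    ∀ τ : ℝ, HasDerivAt g (m - u τ) τ := by
  have hpi : (2*Real.pi) ≠ 0 := by positivity
  have hw : Continuous (fun s => u s - m) := by fun_prop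
  have hi : ∀ a b, IntervalIntegrable (fun s => u s - m) MeasureTheory.volume a b :=
    fun a b => hw.intervalIntegrable a b
  obtain ⟨W, hWdef⟩ : ∃ W : ℝ → ℝ, W = fun x => ∫ s in (0:ℝ)..x, (u s - m) := ⟨_, rfl⟩
  have hWd : ∀ x, HasDerivAt W (u x - m) x := by
    intro x
    rw [hWdef]
    exact hw.integral_hasStrictDerivAt 0 x |>.hasDerivAt
  have hWc : Continuous W := continuous_iff_continuousAt.2 fun x => (hWd x).continuousAt
  have hwper : Function.Periodic (fun s => u s - m) (2*Real.pi) := by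
    intro x
    simp only [hper]
  have hzero : ∫ s in (0:ℝ)..(2*Real.pi), (u s - m) = 0 := by
    rw [intervalIntegral.integral_sub (hu.intervalIntegrable _ _) (by simp),
      intervalIntegral.integral_const, hm]
    simp only [smul_eq_mul, sub_zero]
    field_simp
    ring
  have hWper : Function.Periodic W (2*Real.pi) := by
    intro x
    have h1 := hwper.intervalIntegral_add_eq x 0
    rw [zero_add, hzero] at h1
    have h2 := intervalIntegral.integral_add_adjacent_intervals (hi 0 x) (hi x (x + 2*Real.pi))
    rw [h1, add_zero] at h2
    rw [hWdef]
    exact h2.symm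
  have hgW : g = fun τ => (1/(2*Real.pi)) * (∫ t in (0:ℝ)..(2*Real.pi), W t) - W τ := by
    rw [hg]
    funext τ
    have h3 : ∀ t, ∫ s in (0:ℝ)..t, (u (τ + s) - m) = W (τ + t) - W τ := by
      intro t
      rw [intervalIntegral.integral_comp_add_left (fun s => u s - m) τ, add_zero, hWdef]
      exact (intervalIntegral.integral_interval_sub_left (hi _ _) (hi _ _)).symm
    simp only [h3]
    have h4 : Continuous fun t => W (τ + t) := by fun_prop
    rw [intervalIntegral.integral_sub (h4.intervalIntegrable _ _) (by simp),
      intervalIntegral.integral_const, intervalIntegral.integral_comp_add_left W τ, add_zero,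
      hWper.intervalIntegral_add_eq τ 0, zero_add]
    simp only [smul_eq_mul, sub_zero]
    field_simp
  intro τ
  rw [hgW]
  have h5 := (hWd τ).const_sub ((1/(2*Real.pi)) * (∫ t in (0:ℝ)..(2*Real.pi), W t))
  rwa [neg_sub] at h5
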